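/- For every q with 1 ≤ q < ∞ there exists a constant C such that for all f ∈ C₀^∞(ℝ³), ‖f‖_{L^{5q}(ℝ³)} ≤ C ‖∂₃ f‖_{L^q(ℝ³)}^{1/5} ‖∇_h(|f|²)‖_{L²(ℝ³)}^{2/5}. -/

import Mathlib

open MeasureTheory

noncomputable section

abbrev E3 := EuclideanSpace ℝ (Fin 3)

def pd (i : Fin 3) (f : E3 → ℝ) : E3 → ℝ :=
  fun x => fderiv ℝ f x (EuclideanSpace.single i 1)

/-- Pointwise norm of the horizontal gradient `∇_h f = (∂₁ f, ∂₂ f)`. -/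
def gradH (f : E3 → ℝ) : E3 → ℝ :=
  fun x => Real.sqrt ((pd 0 f x) ^ 2 + (pd 1 f x) ^ 2)

open scoped ENNReal

/-- One-dimensional Sobolev bound for powers of a compactly supported function. -/
theorem enorm_rpow_le_lintegral_deriv {u : ℝ → ℝ} (hu : ContDiff ℝ 1 u)
    (hc : HasCompactSupport u) {a : ℝ} (ha : 1 ≤ a) (t : ℝ) :
    ‖u t‖ₑ ^ a ≤ ∫⁻ s, ENNReal.ofReal a * (‖u s‖ₑ ^ (a - 1) * ‖deriv u s‖ₑ) := by
  rcases ha.eq_or_lt with rfl | ha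
  · simpa using (hc.enorm_le_lintegral_Ici_deriv hu t).trans (setLIntegral_le_lintegral _ _)
  · have ha0 : 0 < a := by linarith
    have hs : HasCompactSupport fun s => ‖u s‖ ^ a :=
      hc.comp_left (g := fun y : ℝ => ‖y‖ ^ a) (by simp [ha0.ne'])
    have h := (hs.enorm_le_lintegral_Ici_deriv (hu.norm_rpow ha) t).trans
      (setLIntegral_le_lintegral _ _)
    rw [Real.enorm_rpow_of_nonneg (norm_nonneg _) ha0.le, enorm_norm] at h
    refine h.trans_eq (lintegral_congr fun s => ?_)
    have hd := (hasDerivAt_norm_rpow (u s) ha).comp s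
      (hu.differentiable one_ne_zero s).hasDerivAt
    have hd' : deriv (fun s => ‖u s‖ ^ a) s = a * ‖u s‖ ^ (a - 2) * u s * deriv u s := hd.deriv
    have hn : ‖u s‖ ^ (a - 2) * ‖u s‖ = ‖u s‖ ^ (a - 1) := by
      rcases (norm_nonneg (u s)).eq_or_lt with h0 | h0
      · rw [← h0, mul_zero, Real.zero_rpow (by linarith)]
      · rw [← Real.rpow_add_one h0.ne']; ring_nf
    rw [hd', ← enorm_norm (u s), ← Real.enorm_rpow_of_nonneg (norm_nonneg _) (by linarith), ← hn,
      enorm_mul, enorm_mul, enorm_mul, enorm_mul, enorm_norm, Real.enorm_of_nonneg ha0.le]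
    ring

theorem measurePreserving_horizontal :
    MeasurePreserving (fun r : ℝ × ℝ × ℝ => (!₂[r.2.1, r.2.2, r.1] : E3)) := by
  have h : MeasurePreserving (Prod.map id (MeasurableEquiv.finTwoArrow (α := ℝ)).symm)
      (volume : Measure (ℝ × ℝ × ℝ)) volume :=
    (MeasurePreserving.id volume).prod (volume_preserving_finTwoArrow ℝ).symm
  have he : (fun r : ℝ × ℝ × ℝ => (!₂[r.2.1, r.2.2, r.1] : E3)) =
      WithLp.toLp 2 ∘ (MeasurableEquiv.piFinSuccAbove (fun _ : Fin 3 => ℝ) 2).symm ∘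
        Prod.map id (MeasurableEquiv.finTwoArrow (α := ℝ)).symm := by
    funext r
    refine PiLp.ext fun i => ?_
    fin_cases i <;> rfl
  rw [he]
  exact (PiLp.volume_preserving_toLp (Fin 3)).comp
    ((volume_preserving_piFinSuccAbove (fun _ : Fin 3 => ℝ) 2).symm.comp h)

theorem lintegral_E3 {F : E3 → ℝ≥0∞} (hF : Measurable F) :
    ∫⁻ v, F v = ∫⁻ z : ℝ, ∫⁻ p : ℝ × ℝ, F !₂[p.1, p.2, z] := by
  rw [← measurePreserving_horizontal.lintegral_comp hF]
  exact lintegral_prod _ (hF.comp measurePreserving_horizontal.measurable).aemeasurable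

theorem enorm_rpow_le_lintegral_pd {f : E3 → ℝ} (hf : ContDiff ℝ 1 f) (hc : HasCompactSupport f)
    {a : ℝ} (ha : 1 ≤ a) (i : Fin 3) (v : E3) (t : ℝ) :
    ‖f (v + t • EuclideanSpace.single i 1)‖ₑ ^ a ≤
      ∫⁻ s : ℝ, ENNReal.ofReal a * (‖f (v + s • EuclideanSpace.single i 1)‖ₑ ^ (a - 1) *
        ‖pd i f (v + s • EuclideanSpace.single i 1)‖ₑ) := by
  have hiso : Isometry fun s : ℝ => v + s • (EuclideanSpace.single i 1 : E3) :=
    Isometry.of_dist_eq fun s t => by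
      rw [dist_add_left, dist_eq_norm, ← sub_smul, norm_smul]; simp [Real.dist_eq]
  have hline : ContDiff ℝ 1 fun s : ℝ => v + s • (EuclideanSpace.single i 1 : E3) := by fun_prop
  have hd (s : ℝ) : deriv (f ∘ fun s : ℝ => v + s • (EuclideanSpace.single i 1 : E3)) s =
      pd i f (v + s • EuclideanSpace.single i 1) := by
    have hl : HasDerivAt (fun s : ℝ => v + s • (EuclideanSpace.single i 1 : E3))
        (EuclideanSpace.single i 1) s := by
      simpa using ((hasDerivAt_id s).smul_const (EuclideanSpace.single i 1 : E3)).const_add v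
    exact ((hf.differentiable one_ne_zero _).hasFDerivAt.comp_hasDerivAt s hl).deriv
  have h := enorm_rpow_le_lintegral_deriv (hf.comp hline)
    (hc.comp_isClosedEmbedding hiso.isClosedEmbedding) ha t
  simpa only [hd, Function.comp] using h
theorem lintegral_sq_le_of_le_lintegral {U A B : ℝ × ℝ → ℝ≥0∞} (hA : Measurable A)
    (hB : Measurable B) (hUA : ∀ x y, U (x, y) ≤ ∫⁻ s, A (s, y))
    (hUB : ∀ x y, U (x, y) ≤ ∫⁻ s, B (x, s)) :
    ∫⁻ p, U p ^ 2 ≤ (∫⁻ p, A p) * ∫⁻ p, B p := by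
  calc ∫⁻ p, U p ^ 2 ≤ ∫⁻ p : ℝ × ℝ, (∫⁻ s, B (p.1, s)) * ∫⁻ s, A (s, p.2) :=
        lintegral_mono fun p => by rw [sq]; exact mul_le_mul' (hUB p.1 p.2) (hUA p.1 p.2)
    _ = (∫⁻ p, B p) * ∫⁻ p, A p := by
        refine (lintegral_prod_mul hB.lintegral_prod_right'.aemeasurable
          hA.lintegral_prod_left'.aemeasurable).trans ?_
        congr 1
        · exact (lintegral_prod _ hB.aemeasurable).symm
        · exact (lintegral_prod_symm _ hA.aemeasurable).symm
    _ = _ := mul_comm _ _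

theorem continuous_pd {f : E3 → ℝ} (hf : ContDiff ℝ 1 f) (i : Fin 3) : Continuous (pd i f) :=
  (hf.continuous_fderiv one_ne_zero).clm_apply continuous_const

theorem continuous_gradH {f : E3 → ℝ} (hf : ContDiff ℝ 1 f) : Continuous (gradH f) :=
  (((continuous_pd hf 0).pow 2).add ((continuous_pd hf 1).pow 2)).sqrt

theorem pd_sq_abs {f : E3 → ℝ} (hf : ContDiff ℝ 1 f) (i : Fin 3) (v : E3) :
    pd i (fun x => |f x| ^ 2) v = 2 * f v * pd i f v := by
  have h := ((hf.differentiable one_ne_zero v).hasFDerivAt.pow 2).fderiv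
  simp only [sq_abs, pd]
  rw [h]
  simp

theorem enorm_mul_pd_le {f : E3 → ℝ} (hf : ContDiff ℝ 1 f) {i : Fin 3} (hi : i = 0 ∨ i = 1)
    (v : E3) : ‖f v‖ₑ * ‖pd i f v‖ₑ ≤ ‖gradH (fun x => |f x| ^ 2) v‖ₑ := by
  rw [← enorm_mul]
  refine enorm_le_iff_norm_le.2 ?_
  rw [gradH, pd_sq_abs hf, pd_sq_abs hf, Real.norm_of_nonneg (Real.sqrt_nonneg _)]
  refine Real.abs_le_sqrt ?_
  rcases hi with rfl | rfl <;>
    nlinarith [sq_nonneg (f v * pd 0 f v), sq_nonneg (f v * pd 1 f v)]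

theorem enorm_rpow_mul_pd_le {f : E3 → ℝ} (hf : ContDiff ℝ 1 f) {i : Fin 3}
    (hi : i = 0 ∨ i = 1) {a : ℝ} (ha : 2 ≤ a) (v : E3) :
    ‖f v‖ₑ ^ (a - 1) * ‖pd i f v‖ₑ ≤
      ‖f v‖ₑ ^ (a - 2) * ‖gradH (fun x => |f x| ^ 2) v‖ₑ := by
  rw [show a - 1 = (a - 2) + 1 by ring, ENNReal.rpow_add_of_nonneg _ _ (by linarith) zero_le_one,
    ENNReal.rpow_one, mul_assoc]
  gcongr
  exact enorm_mul_pd_le hf hi v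

theorem sq_lintegral_mul_le {α : Type*} [MeasurableSpace α] {μ : Measure α} {F G : α → ℝ≥0∞}
    (hF : AEMeasurable F μ) (hG : AEMeasurable G μ) :
    (∫⁻ x, F x * G x ∂μ) ^ 2 ≤ (∫⁻ x, F x ^ (2 : ℝ) ∂μ) * ∫⁻ x, G x ^ (2 : ℝ) ∂μ := by
  have h := ENNReal.lintegral_mul_le_Lp_mul_Lq μ Real.HolderConjugate.two_two hF hG
  calc (∫⁻ x, F x * G x ∂μ) ^ 2
      ≤ ((∫⁻ x, F x ^ (2 : ℝ) ∂μ) ^ (1 / 2 : ℝ) * (∫⁻ x, G x ^ (2 : ℝ) ∂μ) ^ (1 / 2 : ℝ)) ^ 2 :=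
        pow_le_pow_left' h 2
    _ = _ := by
        rw [mul_pow, ← ENNReal.rpow_mul_natCast, ← ENNReal.rpow_mul_natCast]
        norm_num

theorem lintegral_horizontal_rpow_le {f : E3 → ℝ} (hf : ContDiff ℝ 1 f) (hc : HasCompactSupport f)
    {a : ℝ} (ha : 2 ≤ a) (z : ℝ) :
    ∫⁻ p : ℝ × ℝ, ‖f !₂[p.1, p.2, z]‖ₑ ^ (2 * a) ≤
      ENNReal.ofReal a ^ 2 * ((∫⁻ p : ℝ × ℝ, ‖f !₂[p.1, p.2, z]‖ₑ ^ (2 * a - 4)) *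
        ∫⁻ p : ℝ × ℝ, ‖gradH (fun x => |f x| ^ 2) !₂[p.1, p.2, z]‖ₑ ^ (2 : ℝ)) := by
  set G := gradH fun x => |f x| ^ 2
  have hGc : Continuous G := continuous_gradH (by simpa only [sq_abs] using hf.pow 2)
  have hpt : Continuous fun p : ℝ × ℝ => (!₂[p.1, p.2, z] : E3) := by fun_prop
  have hfm : Measurable fun p : ℝ × ℝ => ‖f !₂[p.1, p.2, z]‖ₑ ^ (a - 2) :=
    (hf.continuous.comp hpt).measurable.enorm.pow_const _
  have hGm : Measurable fun p : ℝ × ℝ => ‖G !₂[p.1, p.2, z]‖ₑ := (hGc.comp hpt).measurable.enorm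
  have hFG : Measurable fun p : ℝ × ℝ =>
      ‖f !₂[p.1, p.2, z]‖ₑ ^ (a - 2) * ‖G !₂[p.1, p.2, z]‖ₑ := hfm.mul hGm
  have hA := hFG.const_mul (ENNReal.ofReal a)
  have hx (x y : ℝ) : ‖f !₂[x, y, z]‖ₑ ^ a ≤
      ∫⁻ s : ℝ, ENNReal.ofReal a * (‖f !₂[s, y, z]‖ₑ ^ (a - 2) * ‖G !₂[s, y, z]‖ₑ) := by
    have he (s : ℝ) : (!₂[0, y, z] : E3) + s • EuclideanSpace.single 0 1 = !₂[s, y, z] :=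
      PiLp.ext fun i => by fin_cases i <;> simp
    have h := enorm_rpow_le_lintegral_pd hf hc (by linarith : 1 ≤ a) 0 !₂[0, y, z] x
    simp only [he] at h
    refine h.trans (lintegral_mono fun s => ?_)
    gcongr ENNReal.ofReal a * ?_
    exact enorm_rpow_mul_pd_le hf (.inl rfl) ha _
  have hy (x y : ℝ) : ‖f !₂[x, y, z]‖ₑ ^ a ≤
      ∫⁻ s : ℝ, ENNReal.ofReal a * (‖f !₂[x, s, z]‖ₑ ^ (a - 2) * ‖G !₂[x, s, z]‖ₑ) := by
    have he (s : ℝ) : (!₂[x, 0, z] : E3) + s • EuclideanSpace.single 1 1 = !₂[x, s, z] :=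
      PiLp.ext fun i => by fin_cases i <;> simp
    have h := enorm_rpow_le_lintegral_pd hf hc (by linarith : 1 ≤ a) 1 !₂[x, 0, z] y
    simp only [he] at h
    refine h.trans (lintegral_mono fun s => ?_)
    gcongr ENNReal.ofReal a * ?_
    exact enorm_rpow_mul_pd_le hf (.inr rfl) ha _
  have h := lintegral_sq_le_of_le_lintegral
    (U := fun p => ‖f !₂[p.1, p.2, z]‖ₑ ^ a) hA hA hx hy
  simp only [← ENNReal.rpow_mul_natCast, Nat.cast_ofNat, mul_comm a 2] at h
  refine h.trans ?_
  rw [lintegral_const_mul _ hFG, ← sq, mul_pow]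
  gcongr
  refine (sq_lintegral_mul_le hfm.aemeasurable hGm.aemeasurable).trans_eq ?_
  simp only [← ENNReal.rpow_mul]
  ring_nf

theorem lintegral_horizontal_rpow_le_pd {f : E3 → ℝ} (hf : ContDiff ℝ 1 f)
    (hc : HasCompactSupport f) {b : ℝ} (hb : 1 ≤ b) (z : ℝ) :
    ∫⁻ p : ℝ × ℝ, ‖f !₂[p.1, p.2, z]‖ₑ ^ b ≤
      ENNReal.ofReal b * ∫⁻ v, ‖f v‖ₑ ^ (b - 1) * ‖pd 2 f v‖ₑ := by
  have hm : Measurable fun v => ENNReal.ofReal b * (‖f v‖ₑ ^ (b - 1) * ‖pd 2 f v‖ₑ) :=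
    ((hf.continuous.measurable.enorm.pow_const _).mul
      (continuous_pd hf 2).measurable.enorm).const_mul _
  have hpt : Continuous fun r : (ℝ × ℝ) × ℝ => (!₂[r.1.1, r.1.2, r.2] : E3) := by fun_prop
  rw [← lintegral_const_mul' _ _ ENNReal.ofReal_ne_top, lintegral_E3 hm,
    ← lintegral_lintegral_swap (f := fun (p : ℝ × ℝ) (s : ℝ) => ENNReal.ofReal b *
      (‖f !₂[p.1, p.2, s]‖ₑ ^ (b - 1) * ‖pd 2 f !₂[p.1, p.2, s]‖ₑ))
      (hm.comp hpt.measurable).aemeasurable]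
  refine lintegral_mono fun p => ?_
  have he (s : ℝ) : (!₂[p.1, p.2, 0] : E3) + s • EuclideanSpace.single 2 1 = !₂[p.1, p.2, s] :=
    PiLp.ext fun i => by fin_cases i <;> simp
  have h := enorm_rpow_le_lintegral_pd hf hc hb 2 !₂[p.1, p.2, 0] z
  simpa only [he] using h

theorem lintegral_rpow_le {f : E3 → ℝ} (hf : ContDiff ℝ 1 f) (hc : HasCompactSupport f)
    {a : ℝ} (ha : 5 / 2 ≤ a) :
    ∫⁻ v, ‖f v‖ₑ ^ (2 * a) ≤
      ENNReal.ofReal a ^ 2 * (ENNReal.ofReal (2 * a - 4) *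
        (∫⁻ v, ‖f v‖ₑ ^ (2 * a - 5) * ‖pd 2 f v‖ₑ)) *
        ∫⁻ v, ‖gradH (fun x => |f x| ^ 2) v‖ₑ ^ (2 : ℝ) := by
  have hGc : Continuous (gradH fun x => |f x| ^ 2) :=
    continuous_gradH (by simpa only [sq_abs] using hf.pow 2)
  have hGm : Measurable fun v => ‖gradH (fun x => |f x| ^ 2) v‖ₑ ^ (2 : ℝ) :=
    hGc.measurable.enorm.pow_const _
  have hGz : Measurable fun z : ℝ =>
      ∫⁻ p : ℝ × ℝ, ‖gradH (fun x => |f x| ^ 2) !₂[p.1, p.2, z]‖ₑ ^ (2 : ℝ) :=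
    (hGm.comp measurePreserving_horizontal.measurable).lintegral_prod_right'
  rw [lintegral_E3 (hf.continuous.measurable.enorm.pow_const _), lintegral_E3 hGm,
    ← lintegral_const_mul _ hGz]
  refine lintegral_mono fun z => (lintegral_horizontal_rpow_le hf hc (by linarith) z).trans ?_
  rw [mul_assoc]
  gcongr
  have h := lintegral_horizontal_rpow_le_pd hf hc (by linarith : 1 ≤ 2 * a - 4) z
  rwa [show 2 * a - 4 - 1 = 2 * a - 5 by ring] at h

theorem lintegral_rpow_mul_le {α : Type*} [MeasurableSpace α] {μ : Measure α} {F G : α → ℝ≥0∞}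
    (hF : AEMeasurable F μ) (hG : AEMeasurable G μ) {q : ℝ} (hq : 1 ≤ q) :
    ∫⁻ x, F x ^ (5 * q - 5) * G x ∂μ ≤
      (∫⁻ x, F x ^ (5 * q) ∂μ) ^ (1 - 1 / q) * (∫⁻ x, G x ^ q ∂μ) ^ (1 / q) := by
  rcases hq.eq_or_lt with rfl | hq
  · simp
  · have hpq := (Real.HolderConjugate.conjExponent hq).symm
    have h := ENNReal.lintegral_mul_le_Lp_mul_Lq μ hpq (hF.pow_const (5 * q - 5)) hG
    have h1 : q - 1 ≠ 0 := by linarith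
    have h2 : (5 * q - 5) * q.conjExponent = 5 * q := by
      rw [Real.conjExponent]; field_simp
    have h3 : 1 / q.conjExponent = 1 - 1 / q := by
      rw [Real.conjExponent]; field_simp
    simpa only [← ENNReal.rpow_mul, h2, h3] using! h

theorem ENNReal.le_of_rpow_le_mul {X D N c : ℝ≥0∞} (hX : X ≠ ⊤) {q : ℝ} (hq : 1 ≤ q)
    (h : X ^ (5 * q) ≤ c * X ^ (5 * q - 5) * D * N ^ (2 : ℝ)) :
    X ≤ c ^ (1 / 5 : ℝ) * D ^ (1 / 5 : ℝ) * N ^ (2 / 5 : ℝ) := by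
  rcases eq_or_ne X 0 with rfl | h0
  · exact zero_le
  have h5 : X ^ (5 : ℝ) ≤ c * D * N ^ (2 : ℝ) := by
    have hY0 : X ^ (5 * q - 5) ≠ 0 := by simp [h0, hX]
    have hYt : X ^ (5 * q - 5) ≠ ⊤ := ENNReal.rpow_ne_top_of_nonneg (by linarith) hX
    rw [← ENNReal.mul_le_mul_iff_right hY0 hYt, ← ENNReal.rpow_add _ _ h0 hX]
    calc X ^ (5 * q - 5 + 5) = X ^ (5 * q) := by ring_nf
      _ ≤ _ := h
      _ = _ := by ring
  calc X = (X ^ (5 : ℝ)) ^ (1 / 5 : ℝ) := by rw [← ENNReal.rpow_mul]; norm_num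
    _ ≤ (c * D * N ^ (2 : ℝ)) ^ (1 / 5 : ℝ) := by gcongr
    _ = _ := by
      rw [ENNReal.mul_rpow_of_nonneg _ _ (by norm_num), ENNReal.mul_rpow_of_nonneg _ _ (by norm_num),
        ← ENNReal.rpow_mul]
      norm_num

/-- `‖f‖_{L^{5q}} ≤ C ‖∂₃ f‖_{L^q}^{1/5} ‖∇_h(|f|²)‖_{L²}^{2/5}` for `f ∈ C₀^∞(ℝ³)`, `1 ≤ q < ∞`. -/
theorem stmt_2 (q : ℝ) (hq1 : 1 ≤ q) :
    ∃ C : ℝ, 0 < C ∧ ∀ f : E3 → ℝ, ContDiff ℝ (⊤ : ℕ∞) f → HasCompactSupport f →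
      eLpNorm f (ENNReal.ofReal (5 * q)) volume ≤
        ENNReal.ofReal C *
          (eLpNorm (pd 2 f) (ENNReal.ofReal q) volume) ^ ((1 : ℝ) / 5) *
          (eLpNorm (gradH fun x => |f x| ^ 2) 2 volume) ^ ((2 : ℝ) / 5) := by
  have hq0 : 0 < q := by linarith
  have hb : 0 < 5 * q - 4 := by linarith
  have hc0 : 0 < (5 * q / 2) ^ 2 * (5 * q - 4) := by positivity
  refine ⟨((5 * q / 2) ^ 2 * (5 * q - 4)) ^ (1 / 5 : ℝ), by positivity, fun f hf hc => ?_⟩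
  rw [← ENNReal.ofReal_rpow_of_nonneg hc0.le (by norm_num)]
  have hf1 : ContDiff ℝ 1 f := hf.of_le (by exact_mod_cast le_top)
  refine ENNReal.le_of_rpow_le_mul
    (hf.continuous.memLp_of_hasCompactSupport hc).eLpNorm_ne_top hq1 ?_
  rw [eLpNorm_eq_lintegral_rpow_enorm_toReal (by simpa using hq0) ENNReal.ofReal_ne_top,
    eLpNorm_eq_lintegral_rpow_enorm_toReal (by simpa using hq0) ENNReal.ofReal_ne_top,
    eLpNorm_eq_lintegral_rpow_enorm_toReal two_ne_zero ENNReal.ofNat_ne_top,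
    ENNReal.toReal_ofReal hq0.le, ENNReal.toReal_ofReal (by positivity), ENNReal.toReal_ofNat,
    ← ENNReal.rpow_mul, ← ENNReal.rpow_mul, ← ENNReal.rpow_mul,
    one_div_mul_cancel (by positivity), one_div_mul_cancel two_ne_zero, ENNReal.rpow_one,
    ENNReal.rpow_one, show 1 / (5 * q) * (5 * q - 5) = 1 - 1 / q by field_simp,
    ENNReal.ofReal_mul (by positivity), ENNReal.ofReal_pow (by positivity)]
  have h := lintegral_rpow_le hf1 hc (by linarith : 5 / 2 ≤ 5 * q / 2)
  rw [show 2 * (5 * q / 2) = 5 * q by ring] at h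
  refine h.trans ?_
  gcongr ?_ * _
  rw [mul_assoc, mul_assoc]
  gcongr
  exact lintegral_rpow_mul_le hf.continuous.measurable.enorm.aemeasurable
    (continuous_pd hf1 2).measurable.enorm.aemeasurable hq1
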